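/- arXiv:1408.1577 — 9 statements merged into one kernel-verified Lean document; each statement's English description precedes it below -/
import Mathlib

section
/- Let ε ∈ (0, 1/2], let Q ⊆ ℝ^d be a packing polytope whose set of integral points Q_I admits an α-integrality-gap verifier for some α ∈ (0,1], and let x* ∈ Q have exactly s ≥ 1 nonzero components. Then there exist finitely many integral points x^1, …, x^k ∈ Q_I and nonnegative reals λ_1, …, λ_k with λ_1 + ⋯ + λ_k = 1 such that (α/(1+4ε))·x* = Σ_{j=1}^k λ_j x^j and k ≤ (s+1)·⌈ε^{-2} ln(s+1)⌉ + s. -/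
open Finset

/-- **Fast convex decomposition (Theorem 1).**
Let `ε ∈ (0, 1/2]`, let `Q ⊆ ℝ^d` be a packing polytope whose set of integral points `QI`
admits an `α`-integrality-gap verifier for some `α ∈ (0,1]`, and let `xstar ∈ Q` have exactly
`s ≥ 1` nonzero components. Then there exist finitely many integral points `x^1, …, x^k ∈ QI`
and nonnegative reals `λ_1, …, λ_k` summing to `1` such that
`(α/(1+4ε)) • xstar = Σ_j λ_j • x^j` and `k ≤ (s+1)·⌈ε^{-2} ln(s+1)⌉ + s`. -/
theorem fast_convex_decomposition
    (d : ℕ) (Q : Set (Fin d → ℝ)) (α ε : ℝ)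
    (hε : 0 < ε ∧ ε ≤ 1/2) (hα : 0 < α ∧ α ≤ 1)
    -- Q is a packing polytope
    (hbdd : Bornology.IsBounded Q) (hconv : Convex ℝ Q)
    (hnonneg : ∀ y ∈ Q, ∀ i, 0 ≤ y i)
    (hpack : ∀ y ∈ Q, ∀ x : Fin d → ℝ, (∀ i, 0 ≤ x i) → (∀ i, x i ≤ y i) → x ∈ Q)
    -- the set of integral points of Q
    (QI : Set (Fin d → ℝ)) (hQI : QI = {x | x ∈ Q ∧ ∀ i, ∃ z : ℤ, x i = (z : ℝ)})
    -- α-integrality-gap verifier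
    (hver : ∀ v : Fin d → ℝ, (∀ i, 0 ≤ v i) → ∀ y ∈ Q, ∃ x ∈ QI,
        α * (∑ i, v i * y i) ≤ ∑ i, v i * x i)
    -- xstar ∈ Q with exactly s ≥ 1 nonzero components
    (xstar : Fin d → ℝ) (hx : xstar ∈ Q)
    (s : ℕ) (hs : 1 ≤ s)
    (hsupp : s = (Finset.univ.filter (fun i => xstar i ≠ 0)).card) :
    ∃ (k : ℕ) (xp : Fin k → Fin d → ℝ) (lam : Fin k → ℝ),
      (∀ j, xp j ∈ QI) ∧ (∀ j, 0 ≤ lam j) ∧ (∑ j, lam j = 1) ∧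
      (∀ i, (α / (1 + 4*ε)) * xstar i = ∑ j, lam j * xp j i) ∧
      k ≤ (s + 1) * ⌈(ε^2)⁻¹ * Real.log (s + 1)⌉₊ + s := by
  classical
  obtain ⟨hε0, hε1⟩ := hε
  obtain ⟨hα0, hα1⟩ := hα
  have hc0 : 0 < α / (1 + 4*ε) := by positivity
  have hcα : α / (1 + 4*ε) ≤ α := div_le_self hα0.le (by linarith)
  set c := α / (1 + 4*ε) with hc
  let ι := {i : Fin d // xstar i ≠ 0}
  let E : (ι → ℝ) → (Fin d → ℝ) := fun y i => if h : xstar i ≠ 0 then y ⟨i, h⟩ else 0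
  have hE : ∀ y (i : ι), E y i.1 = y i := fun y i => by
    exact dif_pos i.2
  have hE0 : ∀ y i, xstar i = 0 → E y i = 0 := fun y i h => by
    simp [E, h]
  have hsum : ∀ (y : ι → ℝ) (g : Fin d → ℝ),
      ∑ i, E y i * g i = ∑ i : ι, y i * g i.1 := by
    intro y g
    have h1 : ∑ i ∈ Finset.univ.filter (fun i => xstar i ≠ 0), E y i * g i
        = ∑ i : ι, E y i.1 * g i.1 :=
      Finset.sum_subtype _ (by simp) _
    rw [← Finset.sum_subset (Finset.filter_subset (fun i => xstar i ≠ 0) Finset.univ), h1]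
    · exact Finset.sum_congr rfl fun i _ => by rw [hE]
    · intro i _ hi
      have : xstar i = 0 := by simpa using hi
      rw [hE0 y i this, zero_mul]
  let T : Set (ι → ℝ) := {y | E y ∈ QI}
  have hTfin : T.Finite := by
    obtain ⟨R, hR⟩ := hbdd.exists_norm_le
    have hf : (Set.pi Set.univ (fun _ : ι => (fun z : ℤ => (z : ℝ)) '' Set.Icc 0 ⌈R⌉)).Finite :=
      Set.Finite.pi fun _ => (Set.finite_Icc _ _).image _
    refine hf.subset ?_
    intro y hy i _
    have hy' : E y ∈ QI := hy
    rw [hQI] at hy'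
    obtain ⟨hyQ, hyz⟩ := hy'
    obtain ⟨z, hz⟩ := hyz i.1
    have h0 := hnonneg _ hyQ i.1
    have h1 := (norm_le_pi_norm (E y) i.1).trans (hR _ hyQ)
    have h2 := (le_abs_self _).trans h1
    rw [hz] at h0 h2
    refine ⟨z, ⟨by exact_mod_cast h0, ?_⟩, ?_⟩
    · have := h2.trans (Int.le_ceil R)
      exact_mod_cast this
    · rw [← hE y i, hz]
  have hmem : (fun i : ι => c * xstar i.1) ∈ convexHull ℝ T := by
    by_contra hn
    obtain ⟨f, u, hf1, hf2⟩ := geometric_hahn_banach_closed_point (convex_convexHull ℝ T)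
      (hTfin.isClosed_convexHull ℝ) hn
    let v : ι → ℝ := fun i => f (fun j => if i = j then 1 else 0)
    have hfv : ∀ y, f y = ∑ i, y i * v i := fun y => by
      have := LinearMap.pi_apply_eq_sum_univ (f : (ι → ℝ) →ₗ[ℝ] ℝ) y
      simpa [v] using this
    let w : ι → ℝ := fun i => max (v i) 0
    have hw : ∀ i, 0 ≤ E w i := fun i => by
      simp only [E]; split_ifs
      · exact le_max_right _ _
      · exact le_rfl
    obtain ⟨x, hxI, hxv⟩ := hver (E w) hw xstar hx
    rw [hsum, hsum] at hxv
    rw [hQI] at hxI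
    obtain ⟨hxQ, hxz⟩ := hxI
    have hx0 := hnonneg x hxQ
    let y : ι → ℝ := fun i => if 0 < v i then x i.1 else 0
    have hyT : y ∈ T := by
      change E y ∈ QI
      rw [hQI]
      refine ⟨hpack x hxQ _ ?_ ?_, ?_⟩
      · intro i; simp only [E, y]; split_ifs <;> simp [hx0 i]
      · intro i; simp only [E, y]; split_ifs <;> simp [hx0 i]
      · intro i
        simp only [E, y]; split_ifs
        · exact hxz i
        · exact ⟨0, by simp⟩
        · exact ⟨0, by simp⟩
    have h1 := hf1 y (subset_convexHull ℝ T hyT)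
    rw [hfv] at h1 hf2
    have h2 : ∑ i, y i * v i = ∑ i : ι, w i * x i.1 := by
      refine Finset.sum_congr rfl fun i _ => ?_
      simp only [y, w]; split_ifs with h
      · rw [max_eq_left h.le, mul_comm]
      · rw [max_eq_right (not_lt.mp h)]; simp
    have h3 : ∑ i : ι, c * xstar i.1 * v i ≤ α * ∑ i : ι, w i * xstar i.1 := by
      rw [Finset.mul_sum]
      refine Finset.sum_le_sum fun i _ => ?_
      have a0 := hnonneg _ hx i.1
      calc c * xstar i.1 * v i ≤ c * xstar i.1 * w i :=
            mul_le_mul_of_nonneg_left (le_max_left _ _) (by positivity)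
        _ ≤ α * xstar i.1 * w i :=
            mul_le_mul_of_nonneg_right (mul_le_mul_of_nonneg_right hcα a0) (le_max_right _ _)
        _ = _ := by ring
    linarith
  obtain ⟨κ, _, z, wt, hz, hai, hpos, hsum1, heq⟩ := eq_pos_convex_span_of_mem_convexHull hmem
  let e := Fintype.equivFin κ
  refine ⟨Fintype.card κ, fun j => E (z (e.symm j)), fun j => wt (e.symm j), ?_, ?_, ?_, ?_, ?_⟩
  · intro j; exact hz ⟨_, rfl⟩
  · intro j; exact (hpos _).le
  · rw [← hsum1]; exact Equiv.sum_comp e.symm wt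
  · intro i
    rw [Equiv.sum_comp e.symm (fun k => wt k * E (z k) i)]
    by_cases hi : xstar i = 0
    · simp [hi, hE0 _ i hi]
    · have := congrFun heq ⟨i, hi⟩
      simp only [Finset.sum_apply, Pi.smul_apply, smul_eq_mul] at this
      rw [← this]
      exact Finset.sum_congr rfl fun k _ => by rw [hE (z k) ⟨i, hi⟩]
  · have h1 := hai.card_le_finrank_succ
    have h2 : Module.finrank ℝ (vectorSpan ℝ (Set.range z)) ≤ s := by
      refine (Submodule.finrank_le _).trans ?_
      rw [Module.finrank_fintype_fun_eq_card, hsupp, Fintype.card_subtype]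
    have h3 : 0 < ⌈(ε^2)⁻¹ * Real.log (s + 1)⌉₊ := by
      rw [Nat.ceil_pos]
      have : (1:ℝ) ≤ s := by exact_mod_cast hs
      have := Real.log_pos (show (1:ℝ) < s + 1 by linarith)
      positivity
    nlinarith
end

section
/- Let ε ∈ (0,1/2] and κ ∈ (0,1]. Let A be an m×n real matrix with nonnegative entries, m ≥ 2, let b ∈ ℝ^m and c ∈ ℝ^n have strictly positive entries, and suppose there exists a feasible point, i.e., some x ≥ 0 with Ax ≥ b. Let O be a function assigning to every nonzero nonnegative z ∈ ℝ^m a column index O(z) ∈ {1,…,n} such that (1/c_{O(z)}) Σ_{i=1}^m z_i a_{i,O(z)}/b_i ≥ κ · max_{j ∈ {1,…,n}} (1/c_j) Σ_{i=1}^m z_i a_{ij}/b_i. Then there exists x̂ ∈ ℝ^n with: x̂ ≥ 0; A x̂ ≥ b; x̂_j > 0 only for indices j in the range of O; at most m·⌈ε^{-2} ln m⌉ components of x̂ are nonzero; and c^T x̂ ≤ ((1+4ε)/κ)·c^T x* for every x* ≥ 0 with A x* ≥ b. -/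
open Finset

structure KInv {m n : ℕ} (N : ℕ) (ε κ : ℝ) (B : Fin m → Fin n → ℝ) (c : Fin n → ℝ)
    (O : (Fin m → ℝ) → Fin n) (x : Fin n → ℝ) (k : Fin m → ℕ) : Prop where
  nn : ∀ j, 0 ≤ x j
  ran : ∀ j, 0 < x j → j ∈ Set.range O
  supp : (Finset.univ.filter (fun j => x j ≠ 0)).card ≤ ∑ i, k i
  load : ∀ i, (k i : ℝ) ≤ ∑ j, B i j * x j
  cap : ∀ i, k i ≤ N
  pot : ∀ x' : Fin n → ℝ, (∀ j, 0 ≤ x' j) → (∀ i, 1 ≤ ∑ j, B i j * x' j) →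
    (∑ i, (if ∑ j, B i j * x j < N then (1-ε)^(∑ j, B i j * x j) else 0)
      ≤ m * Real.exp (-(ε*κ*(∑ j, c j * x j)/(∑ j, c j * x' j))))
  cost : ∀ x' : Fin n → ℝ, (∀ j, 0 ≤ x' j) → (∀ i, 1 ≤ ∑ j, B i j * x' j) →
    ε*κ*(∑ j, c j * x j) ≤ (∑ j, c j * x' j) * (Real.log m - (N+1) * Real.log (1-ε))

lemma k_oracle {m n : ℕ} {κ : ℝ} (hκ : 0 < κ) {B : Fin m → Fin n → ℝ} {c : Fin n → ℝ}
    (hc : ∀ j, 0 < c j) (z : Fin m → ℝ) (hz : ∀ i, 0 ≤ z i) (j0 : Fin n)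
    (hO : ∀ j, κ * ((1 / c j) * ∑ i, z i * B i j) ≤ (1 / c j0) * ∑ i, z i * B i j0)
    (x' : Fin n → ℝ) (hx : ∀ j, 0 ≤ x' j) (hf : ∀ i, 1 ≤ ∑ j, B i j * x' j) :
    κ * (∑ i, z i) * c j0 ≤ (∑ i, z i * B i j0) * ∑ j, c j * x' j := by
  have h1 : ∑ i, z i ≤ ∑ j, x' j * ∑ i, z i * B i j := by
    calc ∑ i, z i ≤ ∑ i, z i * ∑ j, B i j * x' j :=
          Finset.sum_le_sum fun i _ => le_mul_of_one_le_right (hz i) (hf i)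
      _ = _ := by
        simp_rw [Finset.mul_sum]
        rw [Finset.sum_comm]
        refine Finset.sum_congr rfl fun j _ => Finset.sum_congr rfl fun i _ => by ring
  have h2 : ∀ j, κ * (∑ i, z i * B i j) ≤ ((1 / c j0) * ∑ i, z i * B i j0) * c j := by
    intro j
    have := mul_le_mul_of_nonneg_right (hO j) (hc j).le
    have e : κ * ((1 / c j) * ∑ i, z i * B i j) * c j = κ * (∑ i, z i * B i j) := by
      have := (hc j).ne'
      field_simp
    linarith
  have h3 : κ * ∑ i, z i ≤ ((1 / c j0) * ∑ i, z i * B i j0) * ∑ j, c j * x' j := by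
    calc κ * ∑ i, z i ≤ κ * ∑ j, x' j * ∑ i, z i * B i j := by gcongr
      _ = ∑ j, x' j * (κ * ∑ i, z i * B i j) := by
        rw [Finset.mul_sum]; exact Finset.sum_congr rfl fun j _ => by ring
      _ ≤ ∑ j, x' j * (((1 / c j0) * ∑ i, z i * B i j0) * c j) :=
        Finset.sum_le_sum fun j _ => mul_le_mul_of_nonneg_left (h2 j) (hx j)
      _ = _ := by
        generalize (1 / c j0) * ∑ i, z i * B i j0 = R
        rw [Finset.mul_sum]; exact Finset.sum_congr rfl fun j _ => by ring
  have := mul_le_mul_of_nonneg_right h3 (hc j0).le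
  calc _ ≤ _ := this
    _ = _ := by
      have := (hc j0).ne'
      field_simp

lemma k_bern {ε p : ℝ} (h0 : 0 < ε) (h1 : ε ≤ 1/2) (hp : 0 ≤ p) (hp1 : p ≤ 1) :
    (1-ε)^p ≤ 1 - ε * p := by
  have := rpow_one_add_le_one_add_mul_self (s := -ε) (by linarith) hp hp1
  calc (1-ε)^p = (1 + -ε)^p := by ring_nf
    _ ≤ _ := this
    _ = _ := by ring

lemma k_V {m n : ℕ} (hm : 2 ≤ m) {B : Fin m → Fin n → ℝ} {c : Fin n → ℝ}
    (hc : ∀ j, 0 < c j)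
    (x' : Fin n → ℝ) (hx : ∀ j, 0 ≤ x' j) (hf : ∀ i, 1 ≤ ∑ j, B i j * x' j) :
    0 < ∑ j, c j * x' j := by
  have hnn : ∀ j ∈ Finset.univ, 0 ≤ c j * x' j := fun j _ => mul_nonneg (hc j).le (hx j)
  rcases (Finset.sum_nonneg hnn).lt_or_eq with h | h
  · exact h
  · exfalso
    have h2 := (Finset.sum_eq_zero_iff_of_nonneg hnn).1 h.symm
    have h3 : ∀ j, x' j = 0 := fun j => by
      rcases mul_eq_zero.1 (h2 j (Finset.mem_univ _)) with h | h
      · exact absurd h (hc j).ne'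
      · exact h
    have := hf ⟨0, by omega⟩
    simp [h3] at this
    linarith

lemma k_step {m n : ℕ} (hm : 2 ≤ m) {N : ℕ} {ε κ : ℝ} (hε : 0 < ε ∧ ε ≤ 1/2)
    (hκ : 0 < κ) {B : Fin m → Fin n → ℝ} (hB : ∀ i j, 0 ≤ B i j) {c : Fin n → ℝ}
    (hc : ∀ j, 0 < c j) {O : (Fin m → ℝ) → Fin n}
    (hfeas : ∃ x : Fin n → ℝ, (∀ j, 0 ≤ x j) ∧ ∀ i, 1 ≤ ∑ j, B i j * x j)
    (hO : ∀ z : Fin m → ℝ, (∀ i, 0 ≤ z i) → z ≠ 0 → ∀ j,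
      κ * ((1 / c j) * ∑ i, z i * B i j) ≤ (1 / c (O z)) * ∑ i, z i * B i (O z))
    {x : Fin n → ℝ} {k : Fin m → ℕ} (h : KInv N ε κ B c O x k)
    (hact : ∃ i, ∑ j, B i j * x j < N) :
    ∃ x2 k2, KInv N ε κ B c O x2 k2 ∧ ∑ i, k2 i = ∑ i, k i + 1 := by
  classical
  obtain ⟨ia, hia⟩ := hact
  have h1ε : 0 < 1 - ε := by linarith [hε.2]
  set L : Fin m → ℝ := fun i => ∑ j, B i j * x j with hL
  set z : Fin m → ℝ := fun i => if L i < N then (1-ε)^(L i) else 0 with hzdef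
  have hz : ∀ i, 0 ≤ z i := fun i => by
    simp only [hzdef]; split_ifs
    · positivity
    · exact le_rfl
  have hzia : 0 < z ia := by
    simp only [hzdef]; rw [if_pos hia]; positivity
  have hz0 : z ≠ 0 := fun h => by simp [h] at hzia
  have hZ : 0 < ∑ i, z i := Finset.sum_pos' (fun i _ => hz i) ⟨ia, Finset.mem_univ _, hzia⟩
  set j0 := O z with hj0
  have hor := k_oracle hκ hc z hz j0 (hO z hz hz0)
  obtain ⟨x0, hx0, hf0⟩ := hfeas
  have hS : 0 < ∑ i, z i * B i j0 := by
    have h1 := hor x0 hx0 hf0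
    have h2 : 0 < κ * (∑ i, z i) * c j0 := by have := hc j0; positivity
    exact pos_of_mul_pos_left (h2.trans_le h1) (k_V hm hc x0 hx0 hf0).le
  -- active max
  obtain ⟨i0, hi0, hmax⟩ := Finset.exists_max_image (Finset.univ.filter fun i => L i < N)
    (fun i => B i j0) ⟨ia, by simpa using hia⟩
  have hi0 : L i0 < N := by simpa using hi0
  have hmax : ∀ i, L i < N → B i j0 ≤ B i0 j0 := fun i hi => hmax i (by simpa using hi)
  have hM : 0 < B i0 j0 := by
    by_contra hcon
    have : ∑ i, z i * B i j0 ≤ 0 := Finset.sum_nonpos fun i _ => by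
      by_cases hi : L i < N
      · exact mul_nonpos_of_nonneg_of_nonpos (hz i) ((hmax i hi).trans (not_lt.1 hcon))
      · simp [hzdef, hi]
    linarith
  set δ := 1 / B i0 j0 with hδ
  have hδ0 : 0 < δ := by positivity
  have hδ1 : B i0 j0 * δ = 1 := by rw [hδ]; field_simp
  have hp0 : ∀ i, 0 ≤ B i j0 * δ := fun i => mul_nonneg (hB i j0) hδ0.le
  have hp1 : ∀ i, L i < N → B i j0 * δ ≤ 1 := fun i hi => by
    rw [← hδ1]; exact mul_le_mul_of_nonneg_right (hmax i hi) hδ0.le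
  set x2 : Fin n → ℝ := fun j => x j + if j = j0 then δ else 0 with hx2
  have hL2 : ∀ i, ∑ j, B i j * x2 j = L i + B i j0 * δ := fun i => by
    simp [hx2, hL, mul_add, Finset.sum_add_distrib]
  have hC2 : ∑ j, c j * x2 j = ∑ j, c j * x j + c j0 * δ := by
    simp [hx2, mul_add, Finset.sum_add_distrib]
  have key : ∀ x' : Fin n → ℝ, (∀ j, 0 ≤ x' j) → (∀ i, 1 ≤ ∑ j, B i j * x' j) →
      ∑ i, (if L i < N then (1-ε)^(L i + B i j0 * δ) else 0)
      ≤ m * Real.exp (-(ε*κ*(∑ j, c j * x2 j)/(∑ j, c j * x' j))) := by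
    intro x' hx' hf'
    have hV := k_V hm hc x' hx' hf'
    set V := ∑ j, c j * x' j with hVdef
    have ho := hor x' hx' hf'
    have hpot := h.pot x' hx' hf'
    change ∑ i, z i ≤ _ at hpot
    calc ∑ i, (if L i < N then (1-ε)^(L i + B i j0 * δ) else 0)
        ≤ ∑ i, (z i - ε * δ * (z i * B i j0)) := by
          refine Finset.sum_le_sum fun i _ => ?_
          by_cases hi : L i < N
          · simp only [hzdef, if_pos hi]
            rw [Real.rpow_add h1ε]
            have := mul_le_mul_of_nonneg_left (k_bern hε.1 hε.2 (hp0 i) (hp1 i hi))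
              (Real.rpow_nonneg h1ε.le (L i))
            linarith
          · simp [hzdef, hi]
      _ = ∑ i, z i - ε * δ * ∑ i, z i * B i j0 := by
          rw [Finset.sum_sub_distrib, Finset.mul_sum]
      _ ≤ (∑ i, z i) * (1 - ε*κ*(c j0 * δ)/V) := by
          have h1 : κ * (∑ i, z i) * c j0 / V ≤ ∑ i, z i * B i j0 := (div_le_iff₀ hV).2 ho
          have h2 := mul_le_mul_of_nonneg_left h1 (mul_nonneg hε.1.le hδ0.le)
          have h3 : (∑ i, z i) * (1 - ε*κ*(c j0 * δ)/V) =
            (∑ i, z i) - ε * δ * (κ * (∑ i, z i) * c j0 / V) := by ring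
          linarith
      _ ≤ (∑ i, z i) * Real.exp (-(ε*κ*(c j0 * δ)/V)) := by
          refine mul_le_mul_of_nonneg_left ?_ hZ.le
          have := Real.add_one_le_exp (-(ε*κ*(c j0 * δ)/V))
          linarith
      _ ≤ (m * Real.exp (-(ε*κ*(∑ j, c j * x j)/V))) * Real.exp (-(ε*κ*(c j0 * δ)/V)) := by
          gcongr
      _ = _ := by
          rw [mul_assoc, ← Real.exp_add, hC2]
          congr 2
          ring
  refine ⟨x2, Function.update k i0 (k i0 + 1), ?_, ?_⟩
  · have hsum : ∑ i, Function.update k i0 (k i0 + 1) i = ∑ i, k i + 1 := by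
      rw [Finset.sum_update_of_mem (Finset.mem_univ _),
        ← Finset.add_sum_erase _ _ (Finset.mem_univ i0), Finset.sdiff_singleton_eq_erase]
      ring
    constructor
    · intro j
      have := h.nn j
      simp only [hx2]; split_ifs <;> linarith
    · intro j hj
      by_cases hjj : j = j0
      · exact ⟨z, hjj.symm⟩
      · simp only [hx2, if_neg hjj, add_zero] at hj
        exact h.ran j hj
    · rw [hsum]
      calc _ ≤ (insert j0 (Finset.univ.filter (fun j => x j ≠ 0))).card := by
            refine Finset.card_le_card fun j hj => ?_
            by_cases hjj : j = j0
            · simp [hjj]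
            · simp [hx2, hjj] at hj; simp [hj]
        _ ≤ _ := (Finset.card_insert_le _ _).trans (by have := h.supp; omega)
    · intro i
      rw [hL2]
      have h1 := h.load i
      by_cases hi : i = i0
      · subst hi
        simp only [Function.update_self]; push_cast; rw [hδ1]
        change (k i : ℝ) ≤ L i at h1
        linarith
      · rw [Function.update_of_ne hi]
        exact le_add_of_le_of_nonneg h1 (hp0 i)
    · intro i
      by_cases hi : i = i0
      · subst hi
        rw [Function.update_self]
        have h1 : (k i : ℝ) < N := (h.load i).trans_lt hi0
        exact_mod_cast h1
      · rw [Function.update_of_ne hi]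
        exact h.cap i
    · intro x' hx' hf'
      refine le_trans (Finset.sum_le_sum fun i _ => ?_) (key x' hx' hf')
      rw [hL2]
      have := hp0 i
      by_cases hi : L i < N
      · rw [if_pos hi]; split_ifs
        · exact le_rfl
        · positivity
      · rw [if_neg hi, if_neg (by linarith)]
    · intro x' hx' hf'
      have hV := k_V hm hc x' hx' hf'
      have h1 := key x' hx' hf'
      have h2 : (1-ε)^((N:ℝ)+1) ≤ m * Real.exp (-(ε*κ*(∑ j, c j * x2 j)/(∑ j, c j * x' j))) := by
        refine le_trans ?_ h1
        refine le_trans ?_ (Finset.single_le_sum (f := fun i => if L i < N then (1-ε)^(L i + B i j0 * δ) else 0) (fun i _ => ?_) (Finset.mem_univ ia))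
        · beta_reduce
          rw [if_pos hia]
          exact Real.rpow_le_rpow_of_exponent_ge h1ε (by linarith [hε.1])
            (add_le_add hia.le (hp1 ia hia))
        · beta_reduce
          split_ifs
          · positivity
          · exact le_rfl
      have h3 := Real.log_le_log (by positivity) h2
      have hm0 : (m:ℝ) ≠ 0 := by positivity
      rw [Real.log_rpow h1ε, Real.log_mul hm0 (Real.exp_ne_zero _), Real.log_exp] at h3
      have h4 : ε*κ*(∑ j, c j * x2 j)/(∑ j, c j * x' j) ≤ Real.log m - (N+1) * Real.log (1-ε) := by
        linarith
      rw [div_le_iff₀ hV] at h4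
      linarith
  · rw [Finset.sum_update_of_mem (Finset.mem_univ _),
        ← Finset.add_sum_erase _ _ (Finset.mem_univ i0), Finset.sdiff_singleton_eq_erase]
    ring

lemma k_init {m n : ℕ} (hm : 2 ≤ m) {N : ℕ} {ε κ : ℝ} (hε : 0 < ε ∧ ε ≤ 1/2)
    {B : Fin m → Fin n → ℝ} {c : Fin n → ℝ}
    (hc : ∀ j, 0 < c j) {O : (Fin m → ℝ) → Fin n} : KInv N ε κ B c O 0 0 := by
  constructor
  · simp
  · simp
  · simp
  · simp
  · simp
  · intro x' _ _
    simp only [Pi.zero_apply, mul_zero, Finset.sum_const_zero, Real.rpow_zero, zero_div, neg_zero,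
      Real.exp_zero, mul_one]
    split_ifs <;> simp
  · intro x' hx hf
    have := k_V hm hc x' hx hf
    simp only [Pi.zero_apply, mul_zero, Finset.sum_const_zero]
    have h1 : Real.log (1-ε) ≤ 0 := Real.log_nonpos (by linarith [hε.2]) (by linarith [hε.1])
    have h2 : 0 ≤ Real.log m := Real.log_natCast_nonneg m
    have h3 : ((N:ℝ)+1) * Real.log (1-ε) ≤ 0 :=
      mul_nonpos_of_nonneg_of_nonpos (by positivity) h1
    exact mul_nonneg this.le (by linarith)

lemma k_final {m n : ℕ} (hm : 2 ≤ m) {N : ℕ} {ε κ : ℝ} (hε : 0 < ε ∧ ε ≤ 1/2)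
    (hκ : 0 < κ) {B : Fin m → Fin n → ℝ} (hB : ∀ i j, 0 ≤ B i j) {c : Fin n → ℝ}
    (hc : ∀ j, 0 < c j) {O : (Fin m → ℝ) → Fin n}
    (hfeas : ∃ x : Fin n → ℝ, (∀ j, 0 ≤ x j) ∧ ∀ i, 1 ≤ ∑ j, B i j * x j)
    (hO : ∀ z : Fin m → ℝ, (∀ i, 0 ≤ z i) → z ≠ 0 → ∀ j,
      κ * ((1 / c j) * ∑ i, z i * B i j) ≤ (1 / c (O z)) * ∑ i, z i * B i (O z)) :
    ∃ x k, KInv N ε κ B c O x k ∧ ∀ i, (N:ℝ) ≤ ∑ j, B i j * x j := by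
  by_contra hcon
  push Not at hcon
  have : ∀ s : ℕ, ∃ x k, KInv N ε κ B c O x k ∧ ∑ i, k i = s := by
    intro s
    induction s with
    | zero => exact ⟨0, 0, k_init hm hε hc, by simp⟩
    | succ s ih =>
      obtain ⟨x, k, h, hs⟩ := ih
      obtain ⟨x2, k2, h2, hs2⟩ := k_step hm hε hκ hB hc hfeas hO h (hcon x k h)
      exact ⟨x2, k2, h2, by omega⟩
  obtain ⟨x, k, h, hs⟩ := this (m * N + 1)
  have : ∑ i, k i ≤ ∑ i : Fin m, N := Finset.sum_le_sum fun i _ => h.cap i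
  simp at this
  omega

lemma k_log {ε : ℝ} (hε : 0 < ε ∧ ε ≤ 1/2) : -Real.log (1-ε) ≤ ε + 1.5*ε^2 := by
  have h1 : 0 < 1 - ε := by linarith [hε.2]
  have h := Real.abs_log_sub_add_sum_range_le (x := ε) (by rw [abs_of_pos hε.1]; linarith [hε.2]) 2
  rw [abs_of_pos hε.1] at h
  have h2 := (abs_le.1 h).1
  simp [Finset.sum_range_succ] at h2
  have h3 : ε^3/(1-ε) ≤ ε^2 := by
    rw [div_le_iff₀ h1]; nlinarith [sq_nonneg ε, hε.1, hε.2]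
  norm_num at h2 h3 ⊢
  linarith

lemma k_num {m N : ℕ} (hm : 2 ≤ m) {ε : ℝ} (hε : 0 < ε ∧ ε ≤ 1/2)
    (hN : (ε^2)⁻¹ * Real.log m ≤ N) :
    0 < N ∧ Real.log m - (N+1) * Real.log (1-ε) ≤ N * ε * (1 + 4 * ε) := by
  have h2 : Real.log 2 ≤ Real.log m := Real.log_le_log (by norm_num) (by exact_mod_cast hm)
  have h3 := Real.log_two_gt_d9
  have he := hε.1
  have h4 : Real.log m ≤ N * ε^2 := by
    rw [inv_mul_le_iff₀ (by positivity)] at hN; linarith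
  have h5 := k_log hε
  have hN0 : (0:ℝ) < N := by
    by_contra hc
    have : (N:ℝ) * ε^2 ≤ 0 := mul_nonpos_of_nonpos_of_nonneg (not_lt.1 hc) (by positivity)
    linarith
  refine ⟨by exact_mod_cast hN0, ?_⟩
  have h6 : 1 ≤ 1.5 * (N * ε^2) := by linarith
  have h7 : ((N:ℝ)+1) * (-Real.log (1-ε)) ≤ (N+1) * (ε + 1.5*ε^2) := by gcongr
  have h8 : 1 * (ε+1.5*ε^2) ≤ 1.5 * (N * ε^2) * (ε + 1.5*ε^2) := by gcongr
  have h9 : (N * ε^2) * (ε + 1.5*ε^2) ≤ (N * ε^2) * (7/8) := by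
    gcongr; nlinarith [hε.2]
  nlinarith

/-- **Khandekar's algorithm with a κ-approximation oracle (Theorem 2).**
Let `ε ∈ (0,1/2]` and `κ ∈ (0,1]`. Let `A` be an `m×n` nonnegative matrix, `m ≥ 2`,
`b` and `c` strictly positive, and suppose the covering LP `Ax ≥ b, x ≥ 0` is feasible.
Let `O` assign to every nonzero nonnegative `z ∈ ℝ^m` a column `O z` such that
`(1/c_{O z}) Σ_i z_i a_{i,O z}/b_i ≥ κ · max_j (1/c_j) Σ_i z_i a_{ij}/b_i`.
Then there is a feasible `x̂ ≥ 0` supported on the range of `O`, with at most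
`m·⌈ε^{-2} ln m⌉` nonzero components, and `cᵀx̂ ≤ ((1+4ε)/κ)·cᵀx*` for every
feasible `x*`. -/
theorem khandekar_covering
    (m n : ℕ) (hm : 2 ≤ m) (ε κ : ℝ)
    (hε : 0 < ε ∧ ε ≤ 1/2) (hκ : 0 < κ ∧ κ ≤ 1)
    (A : Matrix (Fin m) (Fin n) ℝ) (hA : ∀ i j, 0 ≤ A i j)
    (b : Fin m → ℝ) (hb : ∀ i, 0 < b i)
    (c : Fin n → ℝ) (hc : ∀ j, 0 < c j)
    (hfeas : ∃ x : Fin n → ℝ, (∀ j, 0 ≤ x j) ∧ ∀ i, b i ≤ ∑ j, A i j * x j)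
    (O : (Fin m → ℝ) → Fin n)
    (hO : ∀ z : Fin m → ℝ, (∀ i, 0 ≤ z i) → z ≠ 0 → ∀ j,
      κ * ((1 / c j) * ∑ i, z i * A i j / b i) ≤
        (1 / c (O z)) * ∑ i, z i * A i (O z) / b i) :
    ∃ xh : Fin n → ℝ,
      (∀ j, 0 ≤ xh j) ∧
      (∀ i, b i ≤ ∑ j, A i j * xh j) ∧
      (∀ j, 0 < xh j → j ∈ Set.range O) ∧
      (Finset.univ.filter (fun j => xh j ≠ 0)).card ≤ m * ⌈(ε^2)⁻¹ * Real.log m⌉₊ ∧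
      (∀ x' : Fin n → ℝ, (∀ j, 0 ≤ x' j) → (∀ i, b i ≤ ∑ j, A i j * x' j) →
        ∑ j, c j * xh j ≤ ((1 + 4*ε) / κ) * ∑ j, c j * x' j) := by
  classical
  set B : Fin m → Fin n → ℝ := fun i j => A i j / b i with hBd
  have hB : ∀ i j, 0 ≤ B i j := fun i j => div_nonneg (hA i j) (hb i).le
  have hrow : ∀ (x : Fin n → ℝ) i, ∑ j, B i j * x j = (∑ j, A i j * x j) / b i := by
    intro x i
    rw [Finset.sum_div]
    exact Finset.sum_congr rfl fun j _ => by simp only [hBd]; ring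
  have hfe : ∀ (x : Fin n → ℝ), (∀ i, b i ≤ ∑ j, A i j * x j) →
      ∀ i, 1 ≤ ∑ j, B i j * x j := fun x hx i => by
    rw [hrow, le_div_iff₀ (hb i), one_mul]; exact hx i
  have hO' : ∀ z : Fin m → ℝ, (∀ i, 0 ≤ z i) → z ≠ 0 → ∀ j,
      κ * ((1 / c j) * ∑ i, z i * B i j) ≤ (1 / c (O z)) * ∑ i, z i * B i (O z) := by
    intro z hz hz0 j
    have := hO z hz hz0 j
    simpa only [hBd, mul_div_assoc] using this
  set N := ⌈(ε^2)⁻¹ * Real.log m⌉₊ with hN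
  obtain ⟨hN0, hnum⟩ := k_num hm hε (Nat.le_ceil ((ε^2)⁻¹ * Real.log m))
  rw [← hN] at hN0 hnum
  have hN0 : (0:ℝ) < N := by exact_mod_cast hN0
  obtain ⟨x0, hx0, hf0⟩ := hfeas
  obtain ⟨x, k, h, hfin⟩ := k_final (N := N) hm hε hκ.1 hB hc ⟨x0, hx0, hfe x0 hf0⟩ hO'
  refine ⟨fun j => x j / N, fun j => div_nonneg (h.nn j) hN0.le, ?_, ?_, ?_, ?_⟩
  · intro i
    have h1 := hfin i
    rw [hrow, le_div_iff₀ (hb i)] at h1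
    have h2 : ∑ j, A i j * (x j / N) = (∑ j, A i j * x j) / N := by
      rw [Finset.sum_div]
      exact Finset.sum_congr rfl fun j _ => by ring
    rw [h2, le_div_iff₀ hN0]; linarith
  · intro j hj
    refine h.ran j ?_
    rcases (h.nn j).lt_or_eq with h1 | h1
    · exact h1
    · simp [← h1] at hj
  · have h1 : ∑ i, k i ≤ ∑ i : Fin m, N := Finset.sum_le_sum fun i _ => h.cap i
    simp only [Finset.sum_const, Finset.card_univ, Fintype.card_fin, smul_eq_mul] at h1
    refine le_trans (Finset.card_le_card fun j hj => ?_) (h.supp.trans h1)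
    simp only [Finset.mem_filter, Finset.mem_univ, true_and] at hj ⊢
    intro h0
    simp [h0] at hj
  · intro x' hx' hf'
    have hV := k_V hm hc x' hx' (hfe x' hf')
    have h1 := h.cost x' hx' (hfe x' hf')
    have h2 : ∑ j, c j * (x j / N) = (∑ j, c j * x j) / N := by
      rw [Finset.sum_div]
      exact Finset.sum_congr rfl fun j _ => by ring
    have h3 := h1.trans (mul_le_mul_of_nonneg_left hnum hV.le)
    rw [h2, div_le_iff₀ hN0, div_mul_eq_mul_div, div_mul_eq_mul_div, le_div_iff₀ hκ.1]
    refine le_of_mul_le_mul_left ?_ hε.1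
    linarith
end

section
/- Let ε ∈ (0,1/2], let A be an m×n real matrix with nonnegative entries, m ≥ 2, and let O′ be a function assigning to every z ∈ ℝ^m with z ≥ 0 and Σ_i z_i = 1 a column index O′(z) ∈ {1,…,n} such that Σ_{i=1}^m z_i a_{i,O′(z)} ≥ 1. Then there exists x̂ ∈ ℝ^n with: x̂ ≥ 0; Σ_{j=1}^n a_{ij} x̂_j ≥ 1 for every row i; x̂_j > 0 only for indices j in the range of O′; at most m·⌈ε^{-2} ln m⌉ components of x̂ are nonzero; and Σ_{j=1}^n x̂_j ≤ 1 + 4ε. -/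
open Finset

/-- **Corollary 3: Khandekar's algorithm with the oracle `O′` when `b = 1`, `c = 1`.**
Let `ε ∈ (0,1/2]`, `A` an `m×n` nonnegative matrix, `m ≥ 2`, and let `O′` assign to every
nonnegative `z` with `Σ_i z_i = 1` a column `O′ z` such that `Σ_i z_i a_{i,O′ z} ≥ 1`.
Then there is `x̂ ≥ 0` with `A x̂ ≥ 1` componentwise, supported on the range of `O′`,
with at most `m·⌈ε^{-2} ln m⌉` nonzero components, and `Σ_j x̂_j ≤ 1 + 4ε`. -/
theorem khandekar_covering_unit
    (m n : ℕ) (hm : 2 ≤ m) (ε : ℝ) (hε : 0 < ε ∧ ε ≤ 1/2)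
    (A : Matrix (Fin m) (Fin n) ℝ) (hA : ∀ i j, 0 ≤ A i j)
    (O' : (Fin m → ℝ) → Fin n)
    (hO' : ∀ z : Fin m → ℝ, (∀ i, 0 ≤ z i) → (∑ i, z i = 1) →
      1 ≤ ∑ i, z i * A i (O' z)) :
    ∃ xh : Fin n → ℝ,
      (∀ j, 0 ≤ xh j) ∧
      (∀ i, 1 ≤ ∑ j, A i j * xh j) ∧
      (∀ j, 0 < xh j → j ∈ Set.range O') ∧
      (Finset.univ.filter (fun j => xh j ≠ 0)).card ≤ m * ⌈(ε^2)⁻¹ * Real.log m⌉₊ ∧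
      (∑ j, xh j) ≤ 1 + 4*ε := by
  classical
  obtain ⟨hε0, hε1⟩ := hε
  have : NeZero m := ⟨by omega⟩
  let col : Fin n → (Fin m → ℝ) := fun j i => A i j
  let S : Set (Fin m → ℝ) := col '' Set.range O'
  let D : Set (Fin m → ℝ) := Set.Ici (fun _ => 1)
  have key : ∃ y ∈ convexHull ℝ S, ∀ i, 1 ≤ y i := by
    by_contra hcon
    push Not at hcon
    have hdisj : Disjoint (convexHull ℝ S) D := by
      rw [Set.disjoint_left]
      intro y hy hyD
      obtain ⟨i, hi⟩ := hcon y hy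
      exact absurd (hyD i) (not_le.mpr hi)
    have hfin : S.Finite := (Set.toFinite (Set.range O')).image _
    obtain ⟨f, u, v, h1, h2, h3⟩ := geometric_hahn_banach_compact_closed
      (convex_convexHull ℝ S) (hfin.isCompact_convexHull (𝕜 := ℝ)) (convex_Ici _) isClosed_Ici hdisj
    have hf : ∀ y : Fin m → ℝ, f y = ∑ i, y i * f (Pi.single i 1) := by
      intro y
      conv_lhs => rw [pi_eq_sum_univ' y]
      simp [map_sum]
    set w : Fin m → ℝ := fun i => f (Pi.single i 1) with hw
    have hone : v < f (fun _ => 1) := h3 _ (Set.mem_Ici.mpr le_rfl)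
    have hw0 : ∀ i, 0 ≤ w i := by
      intro i
      by_contra hneg
      push Not at hneg
      set t : ℝ := (f (fun _ => 1) - v) / (- w i) with ht
      have ht0 : 0 ≤ t := div_nonneg (by linarith) (by linarith)
      have hmem : (fun _ => 1) + t • (Pi.single i 1 : Fin m → ℝ) ∈ D := by
        intro k
        by_cases hk : k = i
        · subst hk; simp [ht0]
        · simp [hk]
      have h4 := h3 _ hmem
      rw [map_add, map_smul, smul_eq_mul] at h4
      change v < f (fun _ => 1) + t * w i at h4
      have h5 : t * w i = -(f (fun _ => 1) - v) := by
        rw [ht]; field_simp [hneg.ne]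
      linarith
    have hsum : f (fun _ => 1) = ∑ i, w i := by
      rw [hf]; simp [hw]
    have hcolS : ∀ z, f (col (O' z)) < f (fun _ => 1) := fun z => by
      have := h1 _ (subset_convexHull ℝ S ⟨O' z, ⟨z, rfl⟩, rfl⟩)
      linarith
    have hpos : 0 < ∑ i, w i := by
      refine lt_of_le_of_ne (Finset.sum_nonneg fun i _ => hw0 i) ?_
      intro h0
      have h6 : f (col (O' 0)) < 0 := by rw [h0, ← hsum]; exact hcolS 0
      have h7 : 0 ≤ f (col (O' 0)) := by
        rw [hf]
        exact Finset.sum_nonneg fun i _ => mul_nonneg (hA _ _) (hw0 i)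
      linarith
    set W := ∑ i, w i with hWdef
    have hz := hO' (fun i => w i / W) (fun i => div_nonneg (hw0 i) hpos.le)
      (by rw [← Finset.sum_div]; exact div_self hpos.ne')
    set z : Fin m → ℝ := fun i => w i / W with hzdef
    have h8 := hcolS z
    rw [hsum, hf] at h8
    have h9 : ∑ i, z i * A i (O' z) = (∑ i, col (O' z) i * w i) / W := by
      rw [Finset.sum_div]
      refine Finset.sum_congr rfl fun i _ => ?_
      simp only [hzdef, col]
      ring
    have h10 : ∑ i, z i * A i (O' z) < 1 := by
      rw [h9, div_lt_one hpos]; exact h8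
    linarith
  obtain ⟨y, hy, hy1⟩ := key
  obtain ⟨ι, hι, z, w, hzS, hind, hwpos, hwsum, hwz⟩ := eq_pos_convex_span_of_mem_convexHull hy
  have hg : ∀ i, ∃ j, j ∈ Set.range O' ∧ col j = z i := fun i => by
    obtain ⟨j, hj, h⟩ := hzS ⟨i, rfl⟩
    exact ⟨j, hj, h⟩
  choose g hgr hgz using hg
  have hcard : Fintype.card ι ≤ m + 1 := by
    have h := hind.card_le_finrank_succ
    have h' := Submodule.finrank_le (vectorSpan ℝ (Set.range z))
    rw [Module.finrank_fin_fun] at h'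
    omega
  have hK : 2 ≤ ⌈(ε^2)⁻¹ * Real.log m⌉₊ := by
    have hlog : 0.69 < Real.log m := by
      have h2 : Real.log 2 ≤ Real.log m :=
        Real.log_le_log (by norm_num) (by exact_mod_cast hm)
      have := Real.log_two_gt_d9
      linarith
    have hinv : 4 ≤ (ε^2)⁻¹ := by
      rw [le_inv_comm₀ (by norm_num) (by positivity)]
      nlinarith
    have : 1 < (ε^2)⁻¹ * Real.log m := by nlinarith
    rw [Nat.succ_le_iff, Nat.lt_ceil]
    simpa using this
  refine ⟨fun j => ∑ i with g i = j, w i, fun j => Finset.sum_nonneg fun i _ => (hwpos i).le,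
    ?_, ?_, ?_, ?_⟩
  · intro i
    have : ∑ j, A i j * ∑ k with g k = j, w k = y i := by
      rw [← hwz, Finset.sum_apply]
      rw [← Finset.sum_fiberwise (s := Finset.univ) (g := g)]
      refine Finset.sum_congr rfl fun j _ => ?_
      rw [Finset.mul_sum]
      refine Finset.sum_congr rfl fun k hk => ?_
      have hk' := (Finset.mem_filter.mp hk).2
      rw [Pi.smul_apply, smul_eq_mul, ← hgz k, hk', mul_comm]
    rw [this]; exact hy1 i
  · intro j hj
    obtain ⟨i, hi, _⟩ := Finset.exists_ne_zero_of_sum_ne_zero hj.ne'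
    rw [← (Finset.mem_filter.mp hi).2]
    exact hgr i
  · refine le_trans (Finset.card_le_card (t := Finset.univ.image g) ?_) ?_
    · intro j hj
      obtain ⟨i, hi, _⟩ := Finset.exists_ne_zero_of_sum_ne_zero (Finset.mem_filter.mp hj).2
      exact Finset.mem_image.mpr ⟨i, Finset.mem_univ _, (Finset.mem_filter.mp hi).2⟩
    have h1 : (Finset.univ.image g).card ≤ _ := Finset.card_image_le
    rw [Finset.card_univ] at h1
    have h2 : m * 2 ≤ m * ⌈(ε^2)⁻¹ * Real.log m⌉₊ := Nat.mul_le_mul_left _ hK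
    omega
  · have : ∑ j, ∑ k with g k = j, w k = 1 := by
      rw [Finset.sum_fiberwise, hwsum]
    simp only [this]
    linarith
end

section
/- Let ε ∈ (0,1/2], let Q ⊆ ℝ^d be a packing polytope whose set of integral points Q_I admits an α-integrality-gap verifier for some α ∈ (0,1], and let x* ∈ Q have exactly s ≥ 1 nonzero components. Then there exist finitely many integral points x^1, …, x^k ∈ Q_I and nonnegative reals λ_1, …, λ_k with λ_1 + ⋯ + λ_k = 1 such that Σ_{j=1}^k λ_j x^j ≥ (α/(1+4ε))·x* componentwise and k ≤ (s+1)·⌈ε^{-2} ln(s+1)⌉. -/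
open Finset

/-- **Dominating convex combination (Theorem 4).**
Let `ε ∈ (0, 1/2]`, let `Q ⊆ ℝ^d` be a packing polytope whose set of integral points `QI`
admits an `α`-integrality-gap verifier for some `α ∈ (0,1]`, and let `xstar ∈ Q` have exactly
`s ≥ 1` nonzero components. Then there exist finitely many integral points `x^1, …, x^k ∈ QI`
and nonnegative reals `λ_1, …, λ_k` summing to `1` such that
`Σ_j λ_j • x^j ≥ (α/(1+4ε)) • xstar` componentwise and `k ≤ (s+1)·⌈ε^{-2} ln(s+1)⌉`. -/
theorem dominating_convex_combination
    (d : ℕ) (Q : Set (Fin d → ℝ)) (α ε : ℝ)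
    (hε : 0 < ε ∧ ε ≤ 1/2) (hα : 0 < α ∧ α ≤ 1)
    -- Q is a packing polytope
    (hbdd : Bornology.IsBounded Q) (hconv : Convex ℝ Q)
    (hnonneg : ∀ y ∈ Q, ∀ i, 0 ≤ y i)
    (hpack : ∀ y ∈ Q, ∀ x : Fin d → ℝ, (∀ i, 0 ≤ x i) → (∀ i, x i ≤ y i) → x ∈ Q)
    -- the set of integral points of Q
    (QI : Set (Fin d → ℝ)) (hQI : QI = {x | x ∈ Q ∧ ∀ i, ∃ z : ℤ, x i = (z : ℝ)})
    -- α-integrality-gap verifier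
    (hver : ∀ v : Fin d → ℝ, (∀ i, 0 ≤ v i) → ∀ y ∈ Q, ∃ x ∈ QI,
        α * (∑ i, v i * y i) ≤ ∑ i, v i * x i)
    -- xstar ∈ Q with exactly s ≥ 1 nonzero components
    (xstar : Fin d → ℝ) (hx : xstar ∈ Q)
    (s : ℕ) (hs : 1 ≤ s)
    (hsupp : s = (Finset.univ.filter (fun i => xstar i ≠ 0)).card) :
    ∃ (k : ℕ) (xp : Fin k → Fin d → ℝ) (lam : Fin k → ℝ),
      (∀ j, xp j ∈ QI) ∧ (∀ j, 0 ≤ lam j) ∧ (∑ j, lam j = 1) ∧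
      (∀ i, (α / (1 + 4*ε)) * xstar i ≤ ∑ j, lam j * xp j i) ∧
      k ≤ (s + 1) * ⌈(ε^2)⁻¹ * Real.log (s + 1)⌉₊ := by
  classical
  obtain ⟨hε0, -⟩ := hε
  obtain ⟨hα0, -⟩ := hα
  set c : ℝ := α / (1 + 4*ε) with hc
  have hc1 : c < α := by
    rw [hc, div_lt_iff₀ (by linarith)]
    nlinarith
  let S := {i : Fin d // xstar i ≠ 0}
  have hcard : Fintype.card S = s := by
    rw [hsupp]; exact Fintype.card_subtype _
  have hpos : ∀ i : S, 0 < xstar i.1 := fun i =>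
    lt_of_le_of_ne (hnonneg _ hx _) (Ne.symm i.2)
  have hQInn : ∀ y ∈ QI, ∀ i, 0 ≤ y i := by
    intro y hy i
    rw [hQI] at hy
    exact hnonneg y hy.1 i
  let P : (Fin d → ℝ) → (S → ℝ) := fun x i => x i.1
  let D : Set (S → ℝ) := Set.univ.pi fun i => Set.Ioi (c * xstar i.1)
  have hDo : IsOpen D := isOpen_set_pi Set.finite_univ fun _ _ => isOpen_Ioi
  have hDc : Convex ℝ D := convex_pi fun _ _ => convex_Ioi _
  have hmeet : ∃ p ∈ D, p ∈ convexHull ℝ (P '' QI) := by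
    by_contra hno
    have hdis : Disjoint D (convexHull ℝ (P '' QI)) := by
      rw [Set.disjoint_left]
      intro p hp hp'
      exact hno ⟨p, hp, hp'⟩
    obtain ⟨f, u, hfD, hfC⟩ := geometric_hahn_banach_open hDc hDo (convex_convexHull ℝ _) hdis
    have hf : ∀ x : S → ℝ, f x = ∑ i, x i * f (Pi.single i 1) := by
      intro x
      conv_lhs => rw [pi_eq_sum_univ' x]
      rw [map_sum]
      refine Finset.sum_congr rfl fun i _ => ?_
      rw [map_smul, smul_eq_mul]
    let q : S → ℝ := fun i => α * xstar i.1
    have hq : ∀ (i : S) (t : ℝ), 0 ≤ t → q + t • Pi.single i (1:ℝ) ∈ D := by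
      intro i t ht j _
      have h1 : c * xstar j.1 < α * xstar j.1 := mul_lt_mul_of_pos_right hc1 (hpos j)
      have h2 : 0 ≤ t * (Pi.single i (1:ℝ) : S → ℝ) j := by
        refine mul_nonneg ht ?_
        rw [Pi.single_apply]; split_ifs <;> norm_num
      simp only [Set.mem_Ioi, Pi.add_apply, Pi.smul_apply, smul_eq_mul, q]
      linarith
    have hneg : ∀ i : S, f (Pi.single i 1) ≤ 0 := by
      intro i
      by_contra! h
      have h0 := hfD _ (hq i 0 le_rfl)
      rw [zero_smul, add_zero] at h0
      have h1 := hfD _ (hq i ((u - f q) / f (Pi.single i 1)) (div_nonneg (by linarith) h.le))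
      rw [map_add, map_smul, smul_eq_mul, div_mul_cancel₀ _ h.ne'] at h1
      linarith
    have hqD : f q < u := by
      refine hfD _ ?_
      intro j _
      exact mul_lt_mul_of_pos_right hc1 (hpos j)
    let v : Fin d → ℝ := fun i => if h : xstar i ≠ 0 then - f (Pi.single (⟨i, h⟩ : S) 1) else 0
    have hv : ∀ i, 0 ≤ v i := by
      intro i
      by_cases h : xstar i ≠ 0
      · simp only [v, dif_pos h]
        linarith [hneg ⟨i, h⟩]
      · simp only [v, dif_neg h, le_refl]
    have hsum : ∀ x : Fin d → ℝ, ∑ i, v i * x i = - f (P x) := by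
      intro x
      rw [hf, ← Finset.sum_neg_distrib]
      have : ∑ i, v i * x i = ∑ i ∈ Finset.univ.filter (fun i => xstar i ≠ 0), v i * x i := by
        symm
        apply Finset.sum_subset (Finset.filter_subset _ _)
        intro i _ hi
        have h : ¬ xstar i ≠ 0 := by simpa using hi
        simp only [v, dif_neg h, zero_mul]
      rw [this, Finset.sum_subtype (p := fun i => xstar i ≠ 0) _ (by simp)]
      refine Finset.sum_congr rfl fun i _ => ?_
      simp only [v, dif_pos i.2, P]
      ring
    obtain ⟨x, hxQ, hxv⟩ := hver v hv xstar hx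
    rw [hsum, hsum] at hxv
    have h1 := hfC (P x) (subset_convexHull ℝ _ ⟨x, hxQ, rfl⟩)
    have h2 : f q = α * f (P xstar) := by
      rw [← smul_eq_mul, ← map_smul]; rfl
    linarith
  obtain ⟨p, hpD, hpC⟩ := hmeet
  obtain ⟨ι, _, z, w, hz, hai, hw, hw1, hzp⟩ := eq_pos_convex_span_of_mem_convexHull hpC
  have hz' : ∀ j, ∃ x ∈ QI, P x = z j := fun j => hz ⟨j, rfl⟩
  choose y hy hyz using hz'
  let e := Fintype.equivFin ι
  refine ⟨Fintype.card ι, fun j => y (e.symm j), fun j => w (e.symm j), fun j => hy _,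
    fun j => (hw _).le, ?_, ?_, ?_⟩
  · rw [← hw1]; exact e.symm.sum_comp w
  · intro i
    by_cases h : xstar i ≠ 0
    · have h1 := hpD ⟨i, h⟩ trivial
      rw [e.symm.sum_comp (fun j => w j * y j i)]
      have h2 : ∑ j, w j * y j i = p ⟨i, h⟩ := by
        rw [← hzp, Finset.sum_apply]
        refine Finset.sum_congr rfl fun j _ => ?_
        rw [← hyz]; rfl
      rw [h2]
      exact le_of_lt h1
    · push Not at h
      rw [h, mul_zero]
      exact Finset.sum_nonneg fun j _ => mul_nonneg (hw _).le (hQInn _ (hy _) _)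
  · have h1 := hai.card_le_finrank_succ
    have h2 : Module.finrank ℝ (vectorSpan ℝ (Set.range z)) ≤ s := by
      refine (Submodule.finrank_le _).trans ?_
      rw [Module.finrank_fintype_fun_eq_card, hcard]
    have h3 : 0 < ⌈(ε^2)⁻¹ * Real.log (s + 1)⌉₊ := by
      rw [Nat.ceil_pos]
      have hs' : (1:ℝ) ≤ s := by exact_mod_cast hs
      have := Real.log_pos (show (1:ℝ) < s + 1 by linarith)
      positivity
    calc Fintype.card ι ≤ s + 1 := by omega
      _ ≤ _ := Nat.le_mul_of_pos_right _ h3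
end

section
/- Let Q ⊆ ℝ^d be a packing polytope, let x* ∈ Q have exactly s nonzero components, and suppose x^1, …, x^k ∈ Q_I and λ_1, …, λ_k ≥ 0 satisfy λ_1 + ⋯ + λ_k = 1 and Σ_{j=1}^k λ_j x^j ≥ x* componentwise. Then there exist integral points y^1, …, y^l ∈ Q_I and nonnegative reals μ_1, …, μ_l with μ_1 + ⋯ + μ_l = 1 such that Σ_{j=1}^l μ_j y^j = x* and l ≤ k + s. -/
open Finset

theorem down_hull {ι : Type*} [Fintype ι] [DecidableEq ι] (S : Set (ι → ℝ))
    (hS : ∀ v ∈ S, ∀ t, Function.update v t 0 ∈ S) (w x : ι → ℝ)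
    (hw : w ∈ convexHull ℝ S) (h0 : ∀ i, 0 ≤ x i) (h1 : ∀ i, x i ≤ w i) :
    x ∈ convexHull ℝ S := by
  have hz : ∀ t, ∀ v ∈ convexHull ℝ S, Function.update v t 0 ∈ convexHull ℝ S := by
    intro t v hv
    have hsub : convexHull ℝ S ⊆ {v | Function.update v t 0 ∈ convexHull ℝ S} := by
      apply convexHull_min
      · intro v hv
        exact subset_convexHull ℝ S (hS v hv t)
      · intro a ha b hb p q hp hq hpq
        have := convex_convexHull ℝ S ha hb hp hq hpq
        simp only [Set.mem_setOf_eq]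
        convert this using 1
        ext i
        by_cases h : i = t
        · subst h; simp
        · simp [h]
    exact hsub hv
  have key : ∀ F : Finset ι, (fun i => if i ∈ F then x i else w i) ∈ convexHull ℝ S := by
    intro F
    induction F using Finset.induction_on with
    | empty => simpa using hw
    | insert t F ht ih =>
      have h2 := hz t _ ih
      rcases eq_or_lt_of_le ((h0 t).trans (h1 t)) with hwt | hwt
      · convert ih using 1
        ext i
        by_cases h : i = t
        · subst h
          have := h0 i
          have := h1 i
          simp [ht]; linarith
        · simp [h]
      · have hle : x t / w t ≤ 1 := (div_le_one hwt).2 (h1 t)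
        have := convex_convexHull ℝ S ih h2 (div_nonneg (h0 t) hwt.le)
          (sub_nonneg.2 hle) (by ring)
        convert this using 1
        ext i
        by_cases h : i = t
        · subst h
          simp [ht]
          field_simp
        · simp [h]
          split_ifs <;> ring
  simpa using key Finset.univ

/-- **From dominating convex combination to exact convex decomposition (Theorem 5).**
Let `Q ⊆ ℝ^d` be a packing polytope, `xstar ∈ Q` with exactly `s` nonzero components, and
suppose `x^1, …, x^k ∈ QI` and nonnegative `λ_1, …, λ_k` with `Σ λ_j = 1` satisfy
`Σ_j λ_j • x^j ≥ xstar` componentwise. Then there exist integral points `y^1, …, y^l ∈ QI`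
and nonnegative reals `μ_1, …, μ_l` with `Σ μ_j = 1`, `Σ_j μ_j • y^j = xstar`, and `l ≤ k + s`. -/
theorem dominating_to_exact_decomposition
    (d : ℕ) (Q : Set (Fin d → ℝ))
    -- Q is a packing polytope
    (hbdd : Bornology.IsBounded Q) (hconv : Convex ℝ Q)
    (hnonneg : ∀ y ∈ Q, ∀ i, 0 ≤ y i)
    (hpack : ∀ y ∈ Q, ∀ x : Fin d → ℝ, (∀ i, 0 ≤ x i) → (∀ i, x i ≤ y i) → x ∈ Q)
    -- the set of integral points of Q
    (QI : Set (Fin d → ℝ)) (hQI : QI = {x | x ∈ Q ∧ ∀ i, ∃ z : ℤ, x i = (z : ℝ)})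
    -- xstar ∈ Q with exactly s nonzero components
    (xstar : Fin d → ℝ) (hx : xstar ∈ Q)
    (s : ℕ) (hsupp : s = (Finset.univ.filter (fun i => xstar i ≠ 0)).card)
    -- the dominating convex combination
    (k : ℕ) (xp : Fin k → Fin d → ℝ) (lam : Fin k → ℝ)
    (hxp : ∀ j, xp j ∈ QI) (hlam : ∀ j, 0 ≤ lam j) (hsum : ∑ j, lam j = 1)
    (hdom : ∀ i, xstar i ≤ ∑ j, lam j * xp j i) :
    ∃ (l : ℕ) (yp : Fin l → Fin d → ℝ) (μ : Fin l → ℝ),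
      (∀ j, yp j ∈ QI) ∧ (∀ j, 0 ≤ μ j) ∧ (∑ j, μ j = 1) ∧
      (∀ i, xstar i = ∑ j, μ j * yp j i) ∧ l ≤ k + s := by
  classical
  let T := {i : Fin d // xstar i ≠ 0}
  let e : (T → ℝ) → Fin d → ℝ := fun v i => if h : xstar i ≠ 0 then v ⟨i, h⟩ else 0
  let S : Set (T → ℝ) := {v | e v ∈ QI}
  have hQ : ∀ y ∈ QI, ∀ z : Fin d → ℝ, (∀ i, z i = 0 ∨ z i = y i) → z ∈ QI := by
    intro y hy z hz
    rw [hQI] at hy ⊢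
    refine ⟨hpack y hy.1 z ?_ ?_, ?_⟩
    · intro i
      rcases hz i with h | h <;> rw [h]
      exact hnonneg y hy.1 i
    · intro i
      rcases hz i with h | h <;> rw [h]
      exact hnonneg y hy.1 i
    · intro i
      rcases hz i with h | h <;> rw [h]
      · exact ⟨0, by simp⟩
      · exact hy.2 i
  have hS : ∀ v ∈ S, ∀ t, Function.update v t 0 ∈ S := by
    intro v hv t
    refine hQ _ hv _ ?_
    intro i
    by_cases h : xstar i ≠ 0
    · by_cases h' : (⟨i, h⟩ : T) = t
      · left; simp only [e, dif_pos h, h', Function.update_self]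
      · right; simp only [e, dif_pos h, Function.update_of_ne h']
    · left; simp only [e, dif_neg h]
  have hmem : (fun t : T => xstar t) ∈ convexHull ℝ S := by
    refine down_hull S hS (∑ j, lam j • (fun t : T => xp j t)) _ ?_
      (fun t => hnonneg _ hx t) ?_
    · refine (convex_convexHull ℝ S).sum_mem (fun j _ => hlam j) hsum ?_
      intro j _
      refine subset_convexHull ℝ S (hQ _ (hxp j) _ ?_)
      intro i
      by_cases h : xstar i ≠ 0
      · right; simp only [e, dif_pos h]
      · left; simp only [e, dif_neg h]
    · intro t
      simpa using hdom t
  obtain ⟨ι, hι, z, w, hzS, hind, hw, hw1, hwz⟩ := eq_pos_convex_span_of_mem_convexHull hmem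
  have hcard : Fintype.card ι ≤ s + 1 := by
    have h1 := hind.card_le_finrank_succ
    have h2 := Submodule.finrank_le (vectorSpan ℝ (Set.range z))
    have h3 : Module.finrank ℝ (T → ℝ) = s := by
      rw [Module.finrank_fintype_fun_eq_card, hsupp, Fintype.card_subtype]
    omega
  have hk : 1 ≤ k := by
    rcases Nat.eq_zero_or_pos k with h | h
    · subst h; simp at hsum
    · exact h
  let f := (Fintype.equivFin ι).symm
  refine ⟨Fintype.card ι, fun j => e (z (f j)), fun j => w (f j), ?_, ?_, ?_, ?_, by omega⟩
  · intro j
    exact hzS ⟨f j, rfl⟩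
  · intro j
    exact (hw _).le
  · rw [← hw1]
    exact Equiv.sum_comp f w
  · intro i
    rw [Equiv.sum_comp f (fun a => w a * e (z a) i)]
    by_cases h : xstar i ≠ 0
    · have := congrFun hwz ⟨i, h⟩
      simp only [Finset.sum_apply, Pi.smul_apply, smul_eq_mul] at this
      simp only [e, dif_pos h, this]
    · simp only [e, dif_neg h]
      simpa using h
end

section
/- Fix a player i and ε ∈ [0,1]. Let x̄, x′ ∈ Q be allocations such that v̄(x̄) ≥ (1−ε)·v̄(x′). Define the price p_i(v̄) := max( Σ_{j≠i}(v̄_j(x′) − v̄_j(x̄)) − β_i , 0 ), where β_i = ε·Σ_{j≠i} v̄_j(u^j). Then the utility of the truth-telling player i is nonnegative: v̄_i(x̄) − p_i(v̄) ≥ 0. -/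
open Finset

/-- **Individual rationality of the payment rule (part of Lemma 8).**
Fix a player `i` and `ε ∈ [0,1]`. Let `x̄, x′ ∈ Q` with `v̄(x̄) ≥ (1−ε)·v̄(x′)`, and let
`p_i(v̄) := max( Σ_{j≠i}(v̄_j(x′) − v̄_j(x̄)) − β_i , 0 )` with
`β_i = ε·Σ_{j≠i} v̄_j(u^j)`. Then `v̄_i(x̄) − p_i(v̄) ≥ 0`. -/
theorem individually_rational
    (n : ℕ) (Q : Type*) (vbar : Fin n → Q → ℝ)
    (hv : ∀ j x, 0 ≤ vbar j x)
    (u : Fin n → Q) (hdom : ∀ j, ∀ y : Q, vbar j y ≤ vbar j (u j))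
    (i : Fin n) (ε : ℝ) (hε : 0 ≤ ε ∧ ε ≤ 1)
    (xbar x' : Q)
    (happrox : (1 - ε) * (∑ j, vbar j x') ≤ ∑ j, vbar j xbar) :
    0 ≤ vbar i xbar -
      max ((∑ j ∈ Finset.univ.erase i, (vbar j x' - vbar j xbar)) -
            ε * (∑ j ∈ Finset.univ.erase i, vbar j (u j))) 0 := by
  rw [← Finset.add_sum_erase _ _ (Finset.mem_univ i),
    ← Finset.add_sum_erase _ _ (Finset.mem_univ i)] at happrox
  have hS : ∑ j ∈ Finset.univ.erase i, vbar j x' ≤ ∑ j ∈ Finset.univ.erase i, vbar j (u j) :=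
    Finset.sum_le_sum fun j _ => hdom j x'
  have h1 := mul_le_mul_of_nonneg_left hS hε.1
  have h2 := mul_nonneg (sub_nonneg.2 hε.2) (hv i x')
  rw [sub_nonneg, Finset.sum_sub_distrib]
  refine max_le ?_ (hv i xbar)
  linarith
end

section
/- Fix a player i and ε ∈ [0,1]. Write v′(y) := Σ_{j≠i} v̄_j(y) for y ∈ Q. Let x̄, x′, x ∈ Q be allocations such that v̄(x̄) ≥ (1−ε)·v̄(y) for all y ∈ Q and v′(x′) ≥ (1−ε)·v′(y) for all y ∈ Q (x is arbitrary in Q). Define the prices p_i(v) := max( Σ_{j≠i}(v̄_j(x′) − v̄_j(x)) − β_i , 0 ) and p_i(v̄) := max( Σ_{j≠i}(v̄_j(x′) − v̄_j(x̄)) − β_i , 0 ), where β_i = ε·Σ_{j≠i} v̄_j(u^j). Then the utilities satisfy v̄_i(x̄) − p_i(v̄) ≥ ( v̄_i(x) − p_i(v) ) − ε·v̄_i(x) − 3β_i. -/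
open Finset

/-- **Approximate truthfulness of the payment rule (Lemma 8, inequality (9)).**
Fix a player `i` and `ε ∈ [0,1]`. Let `x̄, x′, x ∈ Q` with `v̄(x̄) ≥ (1−ε)·v̄(y)` for all
`y ∈ Q` and `v′(x′) ≥ (1−ε)·v′(y)` for all `y ∈ Q`, where `v′(y) = Σ_{j≠i} v̄_j(y)`.
With the prices `p_i(v) := max( Σ_{j≠i}(v̄_j(x′) − v̄_j(x)) − β_i , 0 )` and
`p_i(v̄) := max( Σ_{j≠i}(v̄_j(x′) − v̄_j(x̄)) − β_i , 0 )`, where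
`β_i = ε·Σ_{j≠i} v̄_j(u^j)`, the utilities satisfy
`v̄_i(x̄) − p_i(v̄) ≥ (v̄_i(x) − p_i(v)) − ε·v̄_i(x) − 3β_i`. -/
theorem approximately_truthful
    (n : ℕ) (Q : Type*) (vbar : Fin n → Q → ℝ)
    (hv : ∀ j x, 0 ≤ vbar j x)
    (u : Fin n → Q) (hdom : ∀ j, ∀ y : Q, vbar j y ≤ vbar j (u j))
    (i : Fin n) (ε : ℝ) (hε : 0 ≤ ε ∧ ε ≤ 1)
    (xbar x' x : Q)
    (hxbar : ∀ y : Q, (1 - ε) * (∑ j, vbar j y) ≤ ∑ j, vbar j xbar)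
    (hx' : ∀ y : Q, (1 - ε) * (∑ j ∈ Finset.univ.erase i, vbar j y) ≤
        ∑ j ∈ Finset.univ.erase i, vbar j x') :
    (vbar i x -
        max ((∑ j ∈ Finset.univ.erase i, (vbar j x' - vbar j x)) -
              ε * (∑ j ∈ Finset.univ.erase i, vbar j (u j))) 0)
      - ε * vbar i x - 3 * (ε * (∑ j ∈ Finset.univ.erase i, vbar j (u j)))
    ≤ vbar i xbar -
        max ((∑ j ∈ Finset.univ.erase i, (vbar j x' - vbar j xbar)) -
              ε * (∑ j ∈ Finset.univ.erase i, vbar j (u j))) 0 := by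
  obtain ⟨h0, h1⟩ := hε
  have hb := hxbar x
  have hc := hx' xbar
  rw [← Finset.add_sum_erase _ _ (Finset.mem_univ i),
    ← Finset.add_sum_erase _ _ (Finset.mem_univ i)] at hb
  have hA : ε * ∑ j ∈ Finset.univ.erase i, vbar j x ≤
      ε * ∑ j ∈ Finset.univ.erase i, vbar j (u j) :=
    mul_le_mul_of_nonneg_left (Finset.sum_le_sum fun j _ => hdom j x) h0
  have hB : ε * ∑ j ∈ Finset.univ.erase i, vbar j xbar ≤
      ε * ∑ j ∈ Finset.univ.erase i, vbar j (u j) :=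
    mul_le_mul_of_nonneg_left (Finset.sum_le_sum fun j _ => hdom j xbar) h0
  have hL : 0 ≤ ε * ∑ j ∈ Finset.univ.erase i, vbar j (u j) :=
    mul_nonneg h0 (Finset.sum_nonneg fun j _ => hv j _)
  simp only [Finset.sum_sub_distrib]
  generalize ∑ j ∈ Finset.univ.erase i, vbar j x = A at *
  generalize ∑ j ∈ Finset.univ.erase i, vbar j xbar = B at *
  generalize ∑ j ∈ Finset.univ.erase i, vbar j x' = C at *
  generalize ε * ∑ j ∈ Finset.univ.erase i, vbar j (u j) = β at *
  have hm := le_max_left (C - A - β) 0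
  rcases max_cases (C - B - β) 0 with ⟨h, _⟩ | ⟨h, _⟩ <;> rw [h] <;> linarith
end

section
/- Let A be an m×n real matrix with nonnegative entries a_{ij}, let b ∈ ℝ^m and c ∈ ℝ^n have strictly positive entries, let κ ∈ (0,1], and let x* ∈ ℝ^n satisfy x* ≥ 0, Ax* ≥ b componentwise, and z* := c^T x* > 0. Suppose that for t = 1, …, t₀ we are given a nonzero nonnegative vector p(t) ∈ ℝ^m, a real δ(t) ≥ 0, and an index j(t) ∈ {1,…,n} such that (1/c_{j(t)}) Σ_{i=1}^m p_i(t) a_{i,j(t)}/b_i ≥ κ · (1/c_j) Σ_{i=1}^m p_i(t) a_{ij}/b_i for every j ∈ {1,…,n}. Then Σ_{t=1}^{t₀} δ(t) · ( Σ_{i=1}^m p_i(t) a_{i,j(t)}/b_i ) / ( Σ_{i=1}^m p_i(t) ) ≥ κ · ( Σ_{t=1}^{t₀} c_{j(t)} δ(t) ) / z*. -/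
open Finset

/-- **Claim 1 in the analysis of Khandekar's algorithm.**
Given a feasible `x* ≥ 0` of the covering LP with `z* = cᵀx* > 0`, weight vectors `p t`
(nonzero, nonnegative), step sizes `δ t ≥ 0`, and oracle columns `j t` satisfying the
κ-approximation property, one has
`Σ_t δ t · (Σ_i p_i(t) a_{i,j(t)}/b_i) / (Σ_i p_i(t)) ≥ κ·(Σ_t c_{j(t)} δ t)/z*`. -/
theorem khandekar_claim
    (m n : ℕ) (A : Matrix (Fin m) (Fin n) ℝ) (hA : ∀ i j, 0 ≤ A i j)
    (b : Fin m → ℝ) (hb : ∀ i, 0 < b i)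
    (c : Fin n → ℝ) (hc : ∀ j, 0 < c j)
    (κ : ℝ) (hκ : 0 < κ ∧ κ ≤ 1)
    (xstar : Fin n → ℝ) (hx0 : ∀ j, 0 ≤ xstar j)
    (hxfeas : ∀ i, b i ≤ ∑ j, A i j * xstar j)
    (hz : 0 < ∑ j, c j * xstar j)
    (t₀ : ℕ) (p : Fin t₀ → Fin m → ℝ) (δ : Fin t₀ → ℝ) (jt : Fin t₀ → Fin n)
    (hp0 : ∀ t i, 0 ≤ p t i) (hpne : ∀ t, p t ≠ 0) (hδ : ∀ t, 0 ≤ δ t)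
    (horacle : ∀ t, ∀ j,
      κ * ((1 / c j) * ∑ i, p t i * A i j / b i) ≤
        (1 / c (jt t)) * ∑ i, p t i * A i (jt t) / b i) :
    κ * (∑ t, c (jt t) * δ t) / (∑ j, c j * xstar j) ≤
      ∑ t, δ t * (∑ i, p t i * A i (jt t) / b i) / (∑ i, p t i) := by
  rw [Finset.mul_sum, Finset.sum_div]
  apply Finset.sum_le_sum
  intro t _
  have hP : 0 < ∑ i, p t i := by
    obtain ⟨i, hi⟩ := Function.ne_iff.mp (hpne t)
    exact Finset.sum_pos' (fun i _ => hp0 t i)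
      ⟨i, Finset.mem_univ i, lt_of_le_of_ne (hp0 t i) (Ne.symm hi)⟩
  have h1 : ∑ i, p t i ≤ ∑ j, (∑ i, p t i * A i j / b i) * xstar j := by
    simp_rw [Finset.sum_mul]
    rw [Finset.sum_comm]
    apply Finset.sum_le_sum
    intro i _
    have e : ∑ j, p t i * A i j / b i * xstar j
        = p t i / b i * ∑ j, A i j * xstar j := by
      rw [Finset.mul_sum]
      exact Finset.sum_congr rfl (fun j _ => by ring)
    rw [e]
    calc p t i = p t i / b i * b i := by
          rw [div_mul_cancel₀ _ (hb i).ne']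
      _ ≤ _ := mul_le_mul_of_nonneg_left (hxfeas i) (div_nonneg (hp0 t i) (hb i).le)
  have h2 : ∀ j, κ * c (jt t) * (∑ i, p t i * A i j / b i)
      ≤ c j * ∑ i, p t i * A i (jt t) / b i := by
    intro j
    have h := horacle t j
    have h' := mul_le_mul_of_nonneg_left h (mul_pos (hc j) (hc (jt t))).le
    have hj := (hc j).ne'
    have hjt := (hc (jt t)).ne'
    calc _ = c j * c (jt t) * (κ * (1 / c j * ∑ i, p t i * A i j / b i)) := by
          field_simp
      _ ≤ _ := h'
      _ = _ := by field_simp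
  have h3 : κ * c (jt t) * ∑ j, (∑ i, p t i * A i j / b i) * xstar j
      ≤ (∑ j, c j * xstar j) * ∑ i, p t i * A i (jt t) / b i := by
    rw [Finset.mul_sum, Finset.sum_mul]
    apply Finset.sum_le_sum
    intro j _
    have := mul_le_mul_of_nonneg_right (h2 j) (hx0 j)
    linarith
  have h4 := mul_le_mul_of_nonneg_left h1 (mul_pos hκ.1 (hc (jt t))).le
  have h5 := mul_le_mul_of_nonneg_left (h4.trans h3) (hδ t)
  rw [div_le_div_iff₀ hz hP]
  linarith
end

section
/- Let ε ∈ (0,1), let L be a nonempty finite index set, and for each i ∈ L let y_i ∈ ℝ and d_i ∈ [0,1]. Set p_i := (1−ε)^{y_i} and P := Σ_{i∈L} p_i. Then Σ_{i∈L} (1−ε)^{y_i + d_i} ≤ P · exp( −ε · ( Σ_{i∈L} p_i d_i ) / P ). -/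
open Finset

/-- **Potential-decrease inequality of one multiplicative-weights step.**
Let `ε ∈ (0,1)`, `L` a nonempty finite index set, and for `i ∈ L` let `y_i ∈ ℝ` and
`d_i ∈ [0,1]`. With `p_i = (1−ε)^{y_i}` (real powers) and `P = Σ_{i∈L} p_i`, one has
`Σ_{i∈L} (1−ε)^{y_i + d_i} ≤ P · exp(−ε·(Σ_{i∈L} p_i d_i)/P)`. -/
theorem mwu_potential_decrease
    {ι : Type*} (ε : ℝ) (hε : 0 < ε ∧ ε < 1)
    (L : Finset ι) (hL : L.Nonempty)
    (y d : ι → ℝ) (hd : ∀ i ∈ L, 0 ≤ d i ∧ d i ≤ 1) :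
    ∑ i ∈ L, (1 - ε) ^ (y i + d i) ≤
      (∑ i ∈ L, (1 - ε) ^ (y i)) *
        Real.exp (-ε * (∑ i ∈ L, (1 - ε) ^ (y i) * d i) / (∑ i ∈ L, (1 - ε) ^ (y i))) := by
  obtain ⟨h0, h1⟩ := hε
  have hb : 0 < 1 - ε := by linarith
  have hP : 0 < ∑ i ∈ L, (1 - ε) ^ (y i) :=
    Finset.sum_pos (fun i _ => Real.rpow_pos_of_pos hb _) hL
  have key : ∑ i ∈ L, (1 - ε) ^ (y i + d i) ≤
      ∑ i ∈ L, ((1 - ε) ^ (y i) - ε * ((1 - ε) ^ (y i) * d i)) := by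
    apply Finset.sum_le_sum
    intro i hi
    have hB := rpow_one_add_le_one_add_mul_self (s := -ε) (by linarith)
      (hd i hi).1 (hd i hi).2
    rw [← sub_eq_add_neg] at hB
    rw [Real.rpow_add hb]
    have := mul_le_mul_of_nonneg_left hB (Real.rpow_pos_of_pos hb (y i)).le
    linarith
  rw [Finset.sum_sub_distrib, ← Finset.mul_sum] at key
  refine key.trans ?_
  have hE := mul_le_mul_of_nonneg_left (Real.add_one_le_exp
    (-ε * (∑ i ∈ L, (1 - ε) ^ (y i) * d i) / (∑ i ∈ L, (1 - ε) ^ (y i)))) hP.le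
  refine le_trans (le_of_eq ?_) hE
  rw [mul_add, mul_div_cancel₀ _ hP.ne']
  ring
end
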